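/- arXiv:1701.07757 — 3 statements merged into one kernel-verified Lean document; each statement's English description precedes it below -/
import Mathlib

section
/- Let dA, dB ≥ 2 and let ρ be a state on ℂ^{dA} ⊗ ℂ^{dB} that is classical with respect to A. Then ρ is boundary classical: for every ε > 0 there exists a discordant state σ with δ(ρ, σ) ≤ ε. In particular every classical state (classical with respect to both A and B) is boundary classical. -/
open Matrix Kronecker BigOperators
open scoped ComplexOrder

noncomputable section

/-- A quantum state: positive semidefinite, trace one. -/
def IsState {n : Type*} [Fintype n] [DecidableEq n] (ρ : Matrix n n ℂ) : Prop :=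
  ρ.PosSemidef ∧ ρ.trace = 1

/-- Separability on a bipartite system `ℂ^dA ⊗ ℂ^dB`. -/
def SeparableState {dA dB : ℕ} (ρ : Matrix (Fin dA × Fin dB) (Fin dA × Fin dB) ℂ) : Prop :=
  ∃ (m : ℕ) (p : Fin m → ℝ) (A : Fin m → Matrix (Fin dA) (Fin dA) ℂ)
    (B : Fin m → Matrix (Fin dB) (Fin dB) ℂ),
    (∀ k, 0 ≤ p k) ∧ (∑ k, p k) = 1 ∧ (∀ k, IsState (A k)) ∧ (∀ k, IsState (B k)) ∧
    ρ = ∑ k, ((p k : ℂ) • (A k ⊗ₖ B k))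

/-- An entangled state is a state that is not separable. -/
def EntangledState {dA dB : ℕ} (ρ : Matrix (Fin dA × Fin dB) (Fin dA × Fin dB) ℂ) : Prop :=
  IsState ρ ∧ ¬ SeparableState ρ

/-- Trace distance: half the sum of absolute values of the eigenvalues of `ρ - τ`. -/
def traceDist {n : Type*} [Fintype n] [DecidableEq n] (ρ τ : Matrix n n ℂ) : ℝ :=
  if h : (ρ - τ).IsHermitian then (1/2) * ∑ i, |h.eigenvalues i| else 0

/-- Standard basis vector of `ℂ^d`. -/
def bv {d : ℕ} (a : ℕ) (h : a < d) : Fin d → ℂ := Pi.single ⟨a, h⟩ (1 : ℂ)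

/-- Standard basis of `ℂ²`. -/
def ket2 (a : Fin 2) : Fin 2 → ℂ := Pi.single a 1

/-- Standard basis of `ℂ³`. -/
def ket3 (a : Fin 3) : Fin 3 → ℂ := Pi.single a 1

/-- `|+⟩ = (|0⟩+|1⟩)/√2`. -/
def ketPlus : Fin 2 → ℂ := (Real.sqrt 2 : ℂ)⁻¹ • (ket2 0 + ket2 1)

/-- `|−⟩ = (|0⟩−|1⟩)/√2`. -/
def ketMinus : Fin 2 → ℂ := (Real.sqrt 2 : ℂ)⁻¹ • (ket2 0 - ket2 1)

/-- Kronecker product of vectors. -/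
def vecKron {dA dB : ℕ} (v : Fin dA → ℂ) (w : Fin dB → ℂ) : Fin dA × Fin dB → ℂ :=
  fun p => v p.1 * w p.2

/-- `|ψ₊⟩ = (|01⟩+|10⟩)/√2`. -/
def psiPlus : Fin 2 × Fin 2 → ℂ :=
  (Real.sqrt 2 : ℂ)⁻¹ • (vecKron (ket2 0) (ket2 1) + vecKron (ket2 1) (ket2 0))

/-- `|φ₊⟩ = (|00⟩+|11⟩)/√2`. -/
def phiPlus : Fin 2 × Fin 2 → ℂ :=
  (Real.sqrt 2 : ℂ)⁻¹ • (vecKron (ket2 0) (ket2 0) + vecKron (ket2 1) (ket2 1))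

/-- The projector `|v⟩⟨v|`. -/
def proj {n : Type*} (v : n → ℂ) : Matrix n n ℂ := vecMulVec v (star v)

/-- Partial transpose on the first factor. -/
def PT {dA dB : ℕ} (ρ : Matrix (Fin dA × Fin dB) (Fin dA × Fin dB) ℂ) :
    Matrix (Fin dA × Fin dB) (Fin dA × Fin dB) ℂ :=
  Matrix.of fun p q => ρ (q.1, p.2) (p.1, q.2)

/-- `⟨v|M|w⟩`. -/
def braket {n : Type*} [Fintype n] (v : n → ℂ) (M : Matrix n n ℂ) (w : n → ℂ) : ℂ :=
  star v ⬝ᵥ (M *ᵥ w)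

/-- A state is classical with respect to the family of vectors `v` on the `A` side. -/
def ClassicalWrt {dA dB : ℕ} (v : Fin dA → Fin dA → ℂ)
    (ρ : Matrix (Fin dA × Fin dB) (Fin dA × Fin dB) ℂ) : Prop :=
  ∃ (lam : Fin dA → ℝ) (τ : Fin dA → Matrix (Fin dB) (Fin dB) ℂ),
    (∀ i, 0 ≤ lam i) ∧ (∀ i, IsState (τ i)) ∧
    ρ = ∑ i, ((lam i : ℂ) • (proj (v i) ⊗ₖ τ i))

/-- Orthonormality of a family of `dA` vectors of `ℂ^dA` (hence an orthonormal basis). -/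
def IsONBasis {d : ℕ} (v : Fin d → Fin d → ℂ) : Prop :=
  ∀ i j, star (v i) ⬝ᵥ v j = if i = j then 1 else 0

/-- A state is classical with respect to `A` if it is classical w.r.t. some
orthonormal basis of `ℂ^dA`; otherwise it is discordant. -/
def ClassicalA {dA dB : ℕ} (ρ : Matrix (Fin dA × Fin dB) (Fin dA × Fin dB) ℂ) : Prop :=
  ∃ v : Fin dA → Fin dA → ℂ, IsONBasis v ∧ ClassicalWrt v ρ

/-- Hamming weight of a natural number (number of ones in binary). -/
def hammingWt (n : ℕ) : ℕ := (Nat.digits 2 n).sum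

/-- The operator on the first factor cut out of `σ` by the basis indices `b`, `b'` of the second. -/
def blockA {dA dB : ℕ} (σ : Matrix (Fin dA × Fin dB) (Fin dA × Fin dB) ℂ) (b b' : Fin dB) :
    Matrix (Fin dA) (Fin dA) ℂ :=
  Matrix.of fun a a' => σ (a, b) (a', b')

lemma IsONBasis.commute_proj {d : ℕ} {v : Fin d → Fin d → ℂ} (hv : IsONBasis v) (i j : Fin d) :
    Commute (proj (v i)) (proj (v j)) := by
  rcases eq_or_ne i j with rfl | hij
  · exact Commute.refl _
  · rw [Commute, SemiconjBy, proj, proj, vecMulVec_mul_vecMulVec, vecMulVec_mul_vecMulVec,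
      hv i j, hv j i, if_neg hij, if_neg hij.symm]
    simp

/-- All blocks of a state classical with respect to `A` commute. -/
lemma ClassicalA.commute_blockA {dA dB : ℕ}
    {σ : Matrix (Fin dA × Fin dB) (Fin dA × Fin dB) ℂ} (h : ClassicalA σ) (b b' c c' : Fin dB) :
    Commute (blockA σ b b') (blockA σ c c') := by
  obtain ⟨v, hv, lam, τ, -, -, rfl⟩ := h
  have key : ∀ b b', blockA (∑ i, ((lam i : ℂ) • (proj (v i) ⊗ₖ τ i))) b b' =
      ∑ i, ((lam i : ℂ) * τ i b b') • proj (v i) := by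
    intro b b'
    ext a a'
    simp only [blockA, Matrix.of_apply, Matrix.sum_apply, Matrix.smul_apply, kroneckerMap_apply,
      smul_eq_mul]
    exact Finset.sum_congr rfl fun i _ => by ring
  rw [key, key]
  exact Commute.sum_left _ _ _ fun i _ => Commute.sum_right _ _ _ fun j _ =>
    ((hv.commute_proj i j).smul_left _).smul_right _

/-- If two segments start at a commuting pair and pass through commuting pairs at two further
parameters, then they end at a commuting pair. -/
lemma Commute.of_segment {R : Type*} [Ring R] [Algebra ℂ R] {X Y X' Y' : R} {s r : ℂ}
    (hs : s ≠ 0) (hr : r ≠ 0) (hsr : s ≠ r) (h0 : Commute X Y)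
    (h1 : Commute ((1 - s) • X + s • X') ((1 - s) • Y + s • Y'))
    (h2 : Commute ((1 - r) • X + r • X') ((1 - r) • Y + r • Y')) : Commute X' Y' := by
  have h0' : X * Y - Y * X = 0 := sub_eq_zero.2 h0
  have key : ∀ t : ℂ, t ≠ 0 → Commute ((1 - t) • X + t • X') ((1 - t) • Y + t • Y') →
      (1 - t) • (X * Y' - Y' * X + (X' * Y - Y * X')) + t • (X' * Y' - Y' * X') = 0 := by
    intro t ht h
    have h' := sub_eq_zero.2 h.eq
    have e : ((1 - t) • X + t • X') * ((1 - t) • Y + t • Y')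
        - ((1 - t) • Y + t • Y') * ((1 - t) • X + t • X') =
        ((1 - t) ^ 2) • (X * Y - Y * X) +
        t • ((1 - t) • (X * Y' - Y' * X + (X' * Y - Y * X')) + t • (X' * Y' - Y' * X')) := by
      simp only [mul_add, add_mul, smul_mul_assoc, mul_smul_comm]
      module
    rw [e, h0', smul_zero, zero_add] at h'
    exact (smul_eq_zero.1 h').resolve_left ht
  have k1 := key s hs h1
  have k2 := key r hr h2
  set B := X * Y' - Y' * X + (X' * Y - Y * X')
  have e : (s - r) • (X' * Y' - Y' * X') =
      (1 - r) • ((1 - s) • B + s • (X' * Y' - Y' * X'))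
      - (1 - s) • ((1 - r) • B + r • (X' * Y' - Y' * X')) := by
    module
  rw [k1, k2, smul_zero, smul_zero, sub_zero] at e
  exact sub_eq_zero.1 ((smul_eq_zero.1 e).resolve_left (sub_ne_zero.2 hsr))

/-- Mixing `ρ` with weight `t` of another state moves it by at most `t` in trace distance. -/
lemma traceDist_mix_le {n : Type*} [Fintype n] [DecidableEq n] {ρ ω : Matrix n n ℂ}
    (hρ : IsState ρ) (hω : IsState ω) {t : ℝ} (ht : 0 ≤ t) :
    traceDist ρ ((1 - (t : ℂ)) • ρ + (t : ℂ) • ω) ≤ t := by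
  unfold traceDist
  split_ifs with h
  swap
  · exact ht
  set U := (h.eigenvectorUnitary : Matrix n n ℂ)
  have hU : U * Uᴴ = 1 := Unitary.coe_mul_star_self h.eigenvectorUnitary
  have hU' : Uᴴ * U = 1 := Unitary.coe_star_mul_self h.eigenvectorUnitary
  have htr : ∀ M : Matrix n n ℂ, (Uᴴ * M * U).trace = M.trace := fun M => by
    rw [Matrix.trace_mul_cycle, hU, Matrix.one_mul]
  have hsum : ∀ M : Matrix n n ℂ, IsState M → ∑ i, ((Uᴴ * M * U) i i).re = 1 := fun M hM => by
    have := congrArg Complex.re ((htr M).trans hM.2)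
    simpa [Matrix.trace] using this
  have hnn : ∀ M : Matrix n n ℂ, IsState M → ∀ i, 0 ≤ ((Uᴴ * M * U) i i).re := fun M hM i =>
    (Complex.le_def.1 (hM.1.conjTranspose_mul_mul_same U).diag_nonneg).1
  have hdiag : Uᴴ * (ρ - ((1 - (t : ℂ)) • ρ + (t : ℂ) • ω)) * U =
      diagonal (RCLike.ofReal ∘ h.eigenvalues) := by
    have := h.spectral_theorem
    rw [Unitary.conjStarAlgAut_apply] at this
    change _ = U * _ * Uᴴ at this
    conv_lhs => rw [this]
    rw [← Matrix.mul_assoc, ← Matrix.mul_assoc, hU', Matrix.one_mul, Matrix.mul_assoc, hU',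
      Matrix.mul_one]
  have heig : ∀ i, h.eigenvalues i =
      t * (((Uᴴ * ρ * U) i i).re - ((Uᴴ * ω * U) i i).re) := by
    intro i
    have e : ρ - ((1 - (t : ℂ)) • ρ + (t : ℂ) • ω) = (t : ℂ) • (ρ - ω) := by module
    have hm : Uᴴ * ((t : ℂ) • (ρ - ω)) * U = (t : ℂ) • (Uᴴ * ρ * U - Uᴴ * ω * U) := by
      rw [Matrix.mul_smul, Matrix.smul_mul, Matrix.mul_sub, Matrix.sub_mul]
    have := congrArg Complex.re (congrFun (congrFun
      (hm.symm.trans ((congrArg (fun M => Uᴴ * M * U) e).symm.trans hdiag)) i) i)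
    rw [diagonal_apply_eq, Matrix.smul_apply, Matrix.sub_apply, smul_eq_mul,
      Complex.re_ofReal_mul, Complex.sub_re] at this
    exact this.symm
  have hle : ∀ i, |h.eigenvalues i| ≤
      t * (((Uᴴ * ρ * U) i i).re + ((Uᴴ * ω * U) i i).re) := by
    intro i
    rw [heig, abs_mul, abs_of_nonneg ht]
    have h1 := hnn ρ hρ i
    have h2 := hnn ω hω i
    gcongr
    rw [abs_le]
    constructor <;> linarith
  have := Finset.sum_le_sum fun i (_ : i ∈ Finset.univ) => hle i
  rw [← Finset.mul_sum, Finset.sum_add_distrib, hsum ρ hρ, hsum ω hω] at this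
  linarith

lemma IsState.mix {n : Type*} [Fintype n] [DecidableEq n] {ρ ω : Matrix n n ℂ}
    (hρ : IsState ρ) (hω : IsState ω) {t : ℝ} (ht : 0 ≤ t) (ht1 : t ≤ 1) :
    IsState ((1 - (t : ℂ)) • ρ + (t : ℂ) • ω) := by
  refine ⟨(hρ.1.smul ?_).add (hω.1.smul ?_), ?_⟩
  · exact_mod_cast sub_nonneg.2 ht1
  · exact_mod_cast ht
  · simp [Matrix.trace_add, Matrix.trace_smul, hρ.2, hω.2]

/-- There is a state (a maximally entangled one of rank two) with two noncommuting blocks. -/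
lemma exists_isState_not_commute_blockA {dA dB : ℕ} (hA : 2 ≤ dA) (hB : 2 ≤ dB) :
    ∃ (ω : Matrix (Fin dA × Fin dB) (Fin dA × Fin dB) ℂ) (b b' c c' : Fin dB),
      IsState ω ∧ ¬ Commute (blockA ω b b') (blockA ω c c') := by
  obtain ⟨a₀, a₁, ha⟩ : ∃ a₀ a₁ : Fin dA, a₀ ≠ a₁ :=
    ⟨⟨0, by omega⟩, ⟨1, by omega⟩, by simp⟩
  obtain ⟨b₀, b₁, hb⟩ : ∃ b₀ b₁ : Fin dB, b₀ ≠ b₁ :=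
    ⟨⟨0, by omega⟩, ⟨1, by omega⟩, by simp⟩
  set w : Fin dA × Fin dB → ℂ := Pi.single (a₀, b₀) 1 + Pi.single (a₁, b₁) 1 with hw
  have hw0 : ∀ a, w (a, b₀) = if a = a₀ then 1 else 0 := fun a => by
    simp [hw, Pi.single_apply, hb]
  have hw1 : ∀ a, w (a, b₁) = if a = a₁ then 1 else 0 := fun a => by
    simp [hw, Pi.single_apply, hb.symm]
  refine ⟨(2⁻¹ : ℂ) • proj w, b₀, b₁, b₁, b₀, ⟨?_, ?_⟩, fun h => ?_⟩
  · exact (posSemidef_vecMulVec_self_star w).smul (by positivity)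
  · have : w ⬝ᵥ star w = 2 := by
      rw [hw, add_dotProduct, single_dotProduct, single_dotProduct]
      simp [ha, ha.symm]
      norm_num
    rw [Matrix.trace_smul, proj, trace_vecMulVec, this]
    simp
  · have h00 := congrFun (congrFun h.eq a₀) a₀
    simp [blockA, Matrix.mul_apply, proj, vecMulVec_apply, hw0, hw1, ha] at h00

/-- every state classical with respect to `A` is boundary classical:
there are discordant states arbitrarily close to it (in particular this holds for every
classical state). -/
theorem stmt_16 (dA dB : ℕ) (hA : 2 ≤ dA) (hB : 2 ≤ dB)
    (ρ : Matrix (Fin dA × Fin dB) (Fin dA × Fin dB) ℂ)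
    (hρ : IsState ρ) (hcl : ClassicalA ρ) :
    ∀ ε : ℝ, 0 < ε → ∃ σ, IsState σ ∧ ¬ ClassicalA σ ∧ traceDist ρ σ ≤ ε := by
  intro ε hε
  obtain ⟨ω, b, b', c, c', hω, hncomm⟩ := exists_isState_not_commute_blockA hA hB
  have hblock : ∀ (t : ℂ) (b b' : Fin dB), blockA ((1 - t) • ρ + t • ω) b b' =
      (1 - t) • blockA ρ b b' + t • blockA ω b b' := fun _ _ _ => rfl
  set s : ℝ := min ε 1 with hs
  have hs0 : 0 < s := lt_min hε one_pos
  have hs1 : s ≤ 1 := min_le_right _ _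
  have hsε : s ≤ ε := min_le_left _ _
  by_contra! hno
  have hclass : ∀ t : ℝ, 0 ≤ t → t ≤ s → ClassicalA ((1 - (t : ℂ)) • ρ + (t : ℂ) • ω) := by
    intro t ht hts
    by_contra hd
    have := hno _ (hρ.mix hω ht (hts.trans hs1)) hd
    linarith [traceDist_mix_le hρ hω ht]
  have h1 := (hclass s hs0.le le_rfl).commute_blockA b b' c c'
  have h2 := (hclass (s / 2) (by positivity) (by linarith)).commute_blockA b b' c c'
  rw [hblock, hblock] at h1 h2
  refine hncomm (Commute.of_segment ?_ ?_ ?_ (hcl.commute_blockA b b' c c') h1 h2)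
  · exact_mod_cast hs0.ne'
  · exact_mod_cast (half_pos hs0).ne'
  · exact_mod_cast (half_lt_self hs0).ne'
end
end

section
/- On ℂ² ⊗ ℂ²: (a) there exists a state ρ that is classical with respect to A, separable, and boundary separable (for every ε > 0 there is an entangled state within trace distance ε of ρ); and (b) there exists a discordant state ρ' that is not boundary separable, i.e. there exists ε > 0 such that every state σ with δ(ρ', σ) ≤ ε is separable. -/
open Matrix Kronecker BigOperators
open scoped ComplexOrder

noncomputable section

/-- Nonnegative combinations of product operators with positive semidefinite factors. -/
def sepCone : AddSubmonoid (Matrix (Fin 2 × Fin 2) (Fin 2 × Fin 2) ℂ) :=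
  AddSubmonoid.closure {M | ∃ A B : Matrix (Fin 2) (Fin 2) ℂ,
    A.PosSemidef ∧ B.PosSemidef ∧ M = A ⊗ₖ B}

lemma kronecker_mem_sepCone {A B : Matrix (Fin 2) (Fin 2) ℂ} (hA : A.PosSemidef)
    (hB : B.PosSemidef) : A ⊗ₖ B ∈ sepCone :=
  AddSubmonoid.subset_closure ⟨A, B, hA, hB, rfl⟩

lemma smul_mem_sepCone {c : ℝ} (hc : 0 ≤ c) {M : Matrix (Fin 2 × Fin 2) (Fin 2 × Fin 2) ℂ}
    (hM : M ∈ sepCone) : (c : ℂ) • M ∈ sepCone := by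
  induction hM using AddSubmonoid.closure_induction with
  | mem x hx =>
    obtain ⟨A, B, hA, hB, rfl⟩ := hx
    rw [← smul_kronecker]
    exact kronecker_mem_sepCone (hA.smul (by exact_mod_cast hc)) hB
  | zero => rw [smul_zero]; exact zero_mem _
  | add x y _ _ hx hy => rw [smul_add]; exact add_mem hx hy

lemma posSemidef_of_mem_sepCone {M : Matrix (Fin 2 × Fin 2) (Fin 2 × Fin 2) ℂ}
    (hM : M ∈ sepCone) : M.PosSemidef := by
  induction hM using AddSubmonoid.closure_induction with
  | mem x hx => obtain ⟨A, B, hA, hB, rfl⟩ := hx; exact hA.kronecker hB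
  | zero => exact PosSemidef.zero
  | add x y _ _ hx hy => exact hx.add hy

lemma isState_single {d : ℕ} (i : Fin d) :
    IsState (Matrix.diagonal (Pi.single i (1 : ℂ))) := by
  refine ⟨PosSemidef.diagonal fun j => ?_, by simp⟩
  by_cases h : j = i
  · subst h; simp
  · simp [h]

/-- Every positive semidefinite matrix is a nonnegative multiple of a state. -/
lemma exists_smul_isState {A : Matrix (Fin 2) (Fin 2) ℂ} (hA : A.PosSemidef) :
    ∃ (t : ℝ) (S : Matrix (Fin 2) (Fin 2) ℂ), 0 ≤ t ∧ IsState S ∧ A = (t : ℂ) • S := by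
  by_cases h : A.trace = 0
  · exact ⟨0, _, le_rfl, isState_single 0, by simp [hA.trace_eq_zero_iff.mp h]⟩
  · have h0 := hA.trace_nonneg
    have hr : (A.trace.re : ℂ) = A.trace := 
      Complex.ext rfl (Complex.nonneg_iff.mp h0).2
    refine ⟨A.trace.re, (A.trace)⁻¹ • A, (Complex.nonneg_iff.mp h0).1,
      ⟨hA.smul (inv_nonneg.mpr h0), ?_⟩, ?_⟩
    · simp [trace_smul, h]
    · rw [hr, smul_smul, mul_inv_cancel₀ h, one_smul]

lemma exists_sum_of_mem_sepCone {M : Matrix (Fin 2 × Fin 2) (Fin 2 × Fin 2) ℂ}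
    (hM : M ∈ sepCone) :
    ∃ (m : ℕ) (p : Fin m → ℝ) (A B : Fin m → Matrix (Fin 2) (Fin 2) ℂ),
      (∀ k, 0 ≤ p k) ∧ (∀ k, IsState (A k)) ∧ (∀ k, IsState (B k)) ∧
      M = ∑ k, ((p k : ℂ) • (A k ⊗ₖ B k)) := by
  induction hM using AddSubmonoid.closure_induction with
  | mem x hx =>
    obtain ⟨A, B, hA, hB, rfl⟩ := hx
    obtain ⟨s, S, hs, hS, rfl⟩ := exists_smul_isState hA
    obtain ⟨t, T, ht, hT, rfl⟩ := exists_smul_isState hB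
    refine ⟨1, fun _ => s * t, fun _ => S, fun _ => T, fun _ => mul_nonneg hs ht,
      fun _ => hS, fun _ => hT, ?_⟩
    rw [smul_kronecker, kronecker_smul, smul_smul, Fin.sum_univ_one, Complex.ofReal_mul]
  | zero => exact ⟨0, ![], ![], ![], by simp⟩
  | add x y _ _ hx hy =>
    obtain ⟨m, p, A, B, hp, hA, hB, rfl⟩ := hx
    obtain ⟨n, q, C, D, hq, hC, hD, rfl⟩ := hy
    refine ⟨m + n, Fin.append p q, Fin.append A C, Fin.append B D, ?_, ?_, ?_, ?_⟩
    · exact fun k => Fin.addCases (by simpa using hp) (by simpa using hq) k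
    · exact fun k => Fin.addCases (by simpa using hA) (by simpa using hC) k
    · exact fun k => Fin.addCases (by simpa using hB) (by simpa using hD) k
    · simp [Fin.sum_univ_add]

lemma separableState_of_mem_sepCone {M : Matrix (Fin 2 × Fin 2) (Fin 2 × Fin 2) ℂ}
    (hM : M ∈ sepCone) (ht : M.trace = 1) : SeparableState M := by
  obtain ⟨m, p, A, B, hp, hA, hB, rfl⟩ := exists_sum_of_mem_sepCone hM
  refine ⟨m, p, A, B, hp, ?_, hA, hB, rfl⟩
  have : (∑ k, (p k : ℂ)) = 1 := by
    simpa [trace_sum, trace_smul, trace_kronecker, (hA _).2, (hB _).2] using ht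
  exact_mod_cast this

lemma smul_one_add_smul_kronecker_mem_sepCone {A B : Matrix (Fin 2) (Fin 2) ℂ}
    (hA : (1 + A).PosSemidef) (hA' : (1 - A).PosSemidef)
    (hB : (1 + B).PosSemidef) (hB' : (1 - B).PosSemidef) {c d : ℝ} (h : |c| ≤ d) :
    (d : ℂ) • (1 : Matrix (Fin 2 × Fin 2) (Fin 2 × Fin 2) ℂ) + (c : ℂ) • (A ⊗ₖ B) ∈ sepCone := by
  obtain ⟨h1, h2⟩ := abs_le.mp h
  have e : (d : ℂ) • (1 : Matrix (Fin 2 × Fin 2) (Fin 2 × Fin 2) ℂ) + (c : ℂ) • (A ⊗ₖ B) =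
      ((((d + c) / 4 : ℝ) : ℂ) • ((1 + A) ⊗ₖ (1 + B)) +
        (((d + c) / 4 : ℝ) : ℂ) • ((1 - A) ⊗ₖ (1 - B))) +
      ((((d - c) / 4 : ℝ) : ℂ) • ((1 + A) ⊗ₖ (1 - B)) +
        (((d - c) / 4 : ℝ) : ℂ) • ((1 - A) ⊗ₖ (1 + B))) := by
    rw [← one_kronecker_one]
    ext i j
    simp only [Matrix.add_apply, Matrix.smul_apply, kroneckerMap_apply, Matrix.sub_apply, smul_eq_mul]
    push_cast
    ring
  rw [e]
  have p1 : 0 ≤ (d + c) / 4 := by linarith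
  have p2 : 0 ≤ (d - c) / 4 := by linarith
  exact add_mem
    (add_mem (smul_mem_sepCone p1 (kronecker_mem_sepCone hA hB)) (smul_mem_sepCone p1 (kronecker_mem_sepCone hA' hB')))
    (add_mem (smul_mem_sepCone p2 (kronecker_mem_sepCone hA hB')) (smul_mem_sepCone p2 (kronecker_mem_sepCone hA' hB)))

/-- The identity followed by the three Pauli matrices. -/
def pauli : Fin 4 → Matrix (Fin 2) (Fin 2) ℂ :=
  ![1, !![0, 1; 1, 0], !![0, -Complex.I; Complex.I, 0], !![1, 0; 0, -1]]

lemma pauli_isHermitian (i : Fin 4) : (pauli i).IsHermitian := by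
  fin_cases i <;> ext a b <;> fin_cases a <;> fin_cases b <;> simp [pauli]

lemma pauli_mul_self (i : Fin 4) : pauli i * pauli i = 1 := by
  fin_cases i <;> ext a b <;> fin_cases a <;> fin_cases b <;>
    simp [pauli, mul_apply]

/-- If `A` is Hermitian and `A² = 1` then `1 + A = (1 + A)ᴴ (1 + A) / 2 ≥ 0`. -/
lemma posSemidef_one_add_of_mul_self {A : Matrix (Fin 2) (Fin 2) ℂ} (hA : A.IsHermitian)
    (h : A * A = 1) : (1 + A).PosSemidef := by
  have e : 1 + A = (1 / 2 : ℂ) • ((1 + A)ᴴ * (1 + A)) := by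
    rw [conjTranspose_add, hA.eq, conjTranspose_one, add_mul, mul_add, mul_add, h]
    simp only [one_mul, mul_one]
    module
  rw [e]
  refine (posSemidef_conjTranspose_mul_self _).smul ?_
  rw [Complex.nonneg_iff]; norm_num

lemma posSemidef_one_add_pauli (i : Fin 4) : (1 + pauli i).PosSemidef :=
  posSemidef_one_add_of_mul_self (pauli_isHermitian i) (pauli_mul_self i)

lemma posSemidef_one_sub_pauli (i : Fin 4) : (1 - pauli i).PosSemidef := by
  rw [sub_eq_add_neg]
  exact posSemidef_one_add_of_mul_self (pauli_isHermitian i).neg (by simp [pauli_mul_self])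

/-- Pauli coefficient of a two-qubit Hermitian operator. -/
def pauliCoeff (H : Matrix (Fin 2 × Fin 2) (Fin 2 × Fin 2) ℂ) (i j : Fin 4) : ℝ :=
  (1 / 4) * ((pauli i ⊗ₖ pauli j) * H).trace.re

lemma sum_pauli_mul_pauli (a b c d : Fin 2) :
    ∑ i, pauli i a b * pauli i c d = if a = d ∧ b = c then 2 else 0 := by
  fin_cases a <;> fin_cases b <;> fin_cases c <;> fin_cases d <;>
    simp [Fin.sum_univ_four, pauli] <;> norm_num

lemma sum_sum_sum_sum_comm {ι κ : Type*} [Fintype ι] [Fintype κ] (G : ι → ι → κ → κ → ℂ) :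
    ∑ i, ∑ j, ∑ p, ∑ q, G i j p q = ∑ p, ∑ q, ∑ i, ∑ j, G i j p q := by
  simpa only [Fintype.sum_prod_type] using Finset.sum_comm (s := Finset.univ)
    (t := Finset.univ) (f := fun (x : ι × ι) (y : κ × κ) => G x.1 x.2 y.1 y.2)

lemma ofReal_pauliCoeff {H : Matrix (Fin 2 × Fin 2) (Fin 2 × Fin 2) ℂ} (hH : H.IsHermitian)
    (i j : Fin 4) : (pauliCoeff H i j : ℂ) = (1 / 4) * ((pauli i ⊗ₖ pauli j) * H).trace := by
  have h : star ((pauli i ⊗ₖ pauli j) * H).trace = ((pauli i ⊗ₖ pauli j) * H).trace := by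
    rw [← trace_conjTranspose, conjTranspose_mul, hH.eq, conjTranspose_kronecker,
      (pauli_isHermitian i).eq, (pauli_isHermitian j).eq, trace_mul_comm]
  rw [pauliCoeff, Complex.ofReal_mul, Complex.conj_eq_iff_re.mp h]
  norm_num

lemma sum_pauliCoeff {H : Matrix (Fin 2 × Fin 2) (Fin 2 × Fin 2) ℂ} (hH : H.IsHermitian) :
    H = ∑ i, ∑ j, (pauliCoeff H i j : ℂ) • (pauli i ⊗ₖ pauli j) := by
  ext r s
  have e : ∀ p q, ∑ i, ∑ j, 1 / 4 * (pauli i p.1 q.1 * pauli j p.2 q.2 * H q p) *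
      (pauli i r.1 s.1 * pauli j r.2 s.2) = if p = s ∧ q = r then H q p else 0 := by
    intro p q
    trans 1 / 4 * H q p * ((∑ i, pauli i p.1 q.1 * pauli i r.1 s.1) *
      ∑ j, pauli j p.2 q.2 * pauli j r.2 s.2)
    · rw [Finset.sum_mul_sum, Finset.mul_sum]
      refine Finset.sum_congr rfl fun i _ => ?_
      rw [Finset.mul_sum]
      exact Finset.sum_congr rfl fun j _ => by ring
    · rw [sum_pauli_mul_pauli, sum_pauli_mul_pauli]
      simp only [Prod.ext_iff]
      split_ifs <;> first | tauto | ring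
  simp only [Matrix.sum_apply, Matrix.smul_apply, kroneckerMap_apply, smul_eq_mul,
    ofReal_pauliCoeff hH, trace, diag_apply, mul_apply, Finset.mul_sum, Finset.sum_mul]
  rw [sum_sum_sum_sum_comm]
  simp only [e]
  simp [ite_and]

lemma abs_pauliCoeff_le {H : Matrix (Fin 2 × Fin 2) (Fin 2 × Fin 2) ℂ} {δ : ℝ}
    (hδ : ∀ p q, ‖H p q‖ ≤ δ) (i j : Fin 4) : |pauliCoeff H i j| ≤ δ := by
  have hre : ∀ p q, |(H p q).re| ≤ δ := fun p q => (Complex.abs_re_le_norm _).trans (hδ p q)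
  have him : ∀ p q, |(H p q).im| ≤ δ := fun p q => (Complex.abs_im_le_norm _).trans (hδ p q)
  simp only [abs_le] at hre him ⊢
  have r := fun a b c d => (hre (a, b) (c, d)).1
  have r' := fun a b c d => (hre (a, b) (c, d)).2
  have s := fun a b c d => (him (a, b) (c, d)).1
  have s' := fun a b c d => (him (a, b) (c, d)).2
  simp only [Fin.forall_fin_two] at r r' s s'
  fin_cases i <;> fin_cases j <;>
  · simp [pauliCoeff, pauli, trace, mul_apply, Fintype.sum_prod_type]
    constructor <;> linarith

lemma one_add_mem_sepCone {H : Matrix (Fin 2 × Fin 2) (Fin 2 × Fin 2) ℂ} (hH : H.IsHermitian)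
    (hδ : ∀ p q, ‖H p q‖ ≤ 1 / 16) : 1 + H ∈ sepCone := by
  have e : 1 + H = ∑ i, ∑ j, (((1 / 16 : ℝ) : ℂ) • (1 : Matrix (Fin 2 × Fin 2) (Fin 2 × Fin 2) ℂ) +
      (pauliCoeff H i j : ℂ) • (pauli i ⊗ₖ pauli j)) := by
    conv_lhs => rw [sum_pauliCoeff hH]
    simp only [Finset.sum_add_distrib, Finset.sum_const, Finset.card_univ, Fintype.card_fin]
    congr 1
    push_cast
    module
  rw [e]
  exact sum_mem fun i _ => sum_mem fun j _ => smul_one_add_smul_kronecker_mem_sepCone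
    (posSemidef_one_add_pauli i) (posSemidef_one_sub_pauli i)
    (posSemidef_one_add_pauli j) (posSemidef_one_sub_pauli j) (abs_pauliCoeff_le hδ i j)

lemma sum_norm_sq_eq_sum_eigenvalues_sq {n : Type*} [Fintype n] [DecidableEq n]
    {M : Matrix n n ℂ} (h : M.IsHermitian) :
    ∑ p, ∑ q, ‖M p q‖ ^ 2 = ∑ i, h.eigenvalues i ^ 2 := by
  have e1 : (M * M).trace = ∑ p, ∑ q, ((‖M p q‖ ^ 2 : ℝ) : ℂ) := by
    simp only [trace, diag_apply, mul_apply]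
    refine Finset.sum_congr rfl fun p _ => Finset.sum_congr rfl fun q _ => ?_
    rw [← h.apply q p, Complex.star_def, Complex.mul_conj, Complex.normSq_eq_norm_sq]
  have e2 : (M * M).trace = ∑ i, ((h.eigenvalues i ^ 2 : ℝ) : ℂ) := by
    conv_lhs => rw [h.spectral_theorem, ← map_mul, Unitary.conjStarAlgAut_apply, trace_mul_cycle]
    simp [trace, pow_two]
  have := e1.symm.trans e2
  exact_mod_cast this

lemma norm_apply_le_traceDist {n : Type*} [Fintype n] [DecidableEq n] {ρ σ : Matrix n n ℂ}
    (h : (ρ - σ).IsHermitian) (p q : n) : ‖(ρ - σ) p q‖ ≤ 2 * traceDist ρ σ := by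
  rw [traceDist, dif_pos h]
  have h0 : 0 ≤ ∑ i, |h.eigenvalues i| := Finset.sum_nonneg fun i _ => abs_nonneg _
  have h1 : ‖(ρ - σ) p q‖ ^ 2 ≤ ∑ p, ∑ q, ‖(ρ - σ) p q‖ ^ 2 :=
    (Finset.single_le_sum (f := fun q => ‖(ρ - σ) p q‖ ^ 2) (fun _ _ => sq_nonneg _)
      (Finset.mem_univ q)).trans
    (Finset.single_le_sum (f := fun p => ∑ q, ‖(ρ - σ) p q‖ ^ 2)
      (fun _ _ => Finset.sum_nonneg fun _ _ => sq_nonneg _) (Finset.mem_univ p))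
  have h2 : ∑ i, h.eigenvalues i ^ 2 ≤ (∑ i, |h.eigenvalues i|) ^ 2 := by
    simpa only [sq_abs] using Finset.sum_sq_le_sq_sum_of_nonneg
      (s := Finset.univ) (f := fun i => |h.eigenvalues i|) fun i _ => abs_nonneg _
  rw [sum_norm_sq_eq_sum_eigenvalues_sq h] at h1
  have := abs_le_of_sq_le_sq (h1.trans h2) h0
  linarith [le_abs_self ‖(ρ - σ) p q‖]

lemma traceDist_sq_le {ρ σ : Matrix (Fin 2 × Fin 2) (Fin 2 × Fin 2) ℂ} :
    traceDist ρ σ ^ 2 ≤ ∑ p, ∑ q, ‖(ρ - σ) p q‖ ^ 2 := by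
  by_cases h : (ρ - σ).IsHermitian
  · rw [traceDist, dif_pos h, sum_norm_sq_eq_sum_eigenvalues_sq h]
    have := sq_sum_le_card_mul_sum_sq (s := Finset.univ) (f := fun i => |h.eigenvalues i|)
    simp only [sq_abs, Finset.card_univ, Fintype.card_prod, Fintype.card_fin] at this
    push_cast at this
    linarith
  · rw [traceDist, dif_neg h, zero_pow two_ne_zero]
    exact Finset.sum_nonneg fun _ _ => Finset.sum_nonneg fun _ _ => sq_nonneg _

lemma SeparableState.posSemidef_PT {ρ : Matrix (Fin 2 × Fin 2) (Fin 2 × Fin 2) ℂ}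
    (h : SeparableState ρ) : (PT ρ).PosSemidef := by
  obtain ⟨m, p, A, B, hp, -, hA, hB, rfl⟩ := h
  have e : PT (∑ k, (p k : ℂ) • (A k ⊗ₖ B k)) = ∑ k, (p k : ℂ) • ((A k)ᵀ ⊗ₖ B k) := by
    ext i j
    simp [PT, Matrix.sum_apply]
  rw [e]
  exact posSemidef_sum _ fun k _ =>
    ((hA k).1.transpose.kronecker (hB k).1).smul (by exact_mod_cast hp k)

/-- The conditional operators of a state classical with respect to `A` commute. -/
lemma ClassicalA.commute {ρ : Matrix (Fin 2 × Fin 2) (Fin 2 × Fin 2) ℂ} (h : ClassicalA ρ)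
    (a b c d : Fin 2) :
    Commute (Matrix.of fun i j => ρ (i, a) (j, b)) (Matrix.of fun i j => ρ (i, c) (j, d)) := by
  obtain ⟨v, hv, lam, τ, -, -, rfl⟩ := h
  have e : ∀ a b, (Matrix.of fun i j => (∑ k, (lam k : ℂ) • (proj (v k) ⊗ₖ τ k)) (i, a) (j, b)) =
      ∑ k, (lam k * τ k a b) • proj (v k) := by
    intro a b
    ext i j
    simp [Matrix.sum_apply]
    ring
  have hc : ∀ k l, Commute (proj (v k)) (proj (v l)) := by
    intro k l
    rcases eq_or_ne k l with rfl | hkl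
    · exact Commute.refl _
    · simp [Commute, SemiconjBy, proj, vecMulVec_mul_vecMulVec, hv k l, hv l k, hkl, hkl.symm]
  rw [e, e]
  exact Commute.sum_left _ _ _ fun k _ => Commute.sum_right _ _ _ fun l _ =>
    ((hc k l).smul_left _).smul_right _

/-- The mixture of `|00⟩⟨00|` and `|φ₊⟩⟨φ₊|` with weights `1 - t` and `t`. -/
def mixPhiPlus (t : ℝ) : Matrix (Fin 2 × Fin 2) (Fin 2 × Fin 2) ℂ :=
  ((1 - t : ℝ) : ℂ) • proj (vecKron (ket2 0) (ket2 0)) + ((t : ℝ) : ℂ) • proj phiPlus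

lemma proj_vecKron (v w : Fin 2 → ℂ) : proj (vecKron v w) = proj v ⊗ₖ proj w := by
  ext i j
  simp [proj, vecKron, vecMulVec_apply]
  ring

lemma proj_vecKron_ket2_apply (p q : Fin 2 × Fin 2) :
    proj (vecKron (ket2 0) (ket2 0)) p q = if p = (0, 0) ∧ q = (0, 0) then 1 else 0 := by
  obtain ⟨a, b⟩ := p
  obtain ⟨c, d⟩ := q
  fin_cases a <;> fin_cases b <;> fin_cases c <;> fin_cases d <;>
    simp [proj, vecKron, vecMulVec_apply, ket2]

lemma proj_phiPlus_apply (p q : Fin 2 × Fin 2) :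
    proj phiPlus p q = if p.1 = p.2 ∧ q.1 = q.2 then 1 / 2 else 0 := by
  have hs : ((Real.sqrt 2 : ℝ) : ℂ)⁻¹ * ((Real.sqrt 2 : ℝ) : ℂ)⁻¹ = 2⁻¹ := by
    rw [← mul_inv, ← Complex.ofReal_mul, Real.mul_self_sqrt (by norm_num)]
    norm_num
  obtain ⟨a, b⟩ := p
  obtain ⟨c, d⟩ := q
  fin_cases a <;> fin_cases b <;> fin_cases c <;> fin_cases d <;>
    simp [proj, phiPlus, vecKron, vecMulVec_apply, ket2, hs]

lemma isState_mixPhiPlus {t : ℝ} (h0 : 0 ≤ t) (h1 : t ≤ 1) : IsState (mixPhiPlus t) := by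
  refine ⟨((posSemidef_vecMulVec_self_star _).smul ?_).add
    ((posSemidef_vecMulVec_self_star _).smul ?_), ?_⟩
  · exact_mod_cast sub_nonneg.mpr h1
  · exact_mod_cast h0
  · simp [mixPhiPlus, trace, Fintype.sum_prod_type, proj_vecKron_ket2_apply, proj_phiPlus_apply]
    ring

lemma entangledState_mixPhiPlus {t : ℝ} (h0 : 0 < t) (h1 : t ≤ 1) :
    EntangledState (mixPhiPlus t) := by
  refine ⟨isState_mixPhiPlus h0.le h1, fun h => ?_⟩
  have := (Complex.nonneg_iff.mp (h.posSemidef_PT.dotProduct_mulVec_nonneg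
    (fun p => if p = (0, 1) then 1 else if p = (1, 0) then -1 else 0))).1
  simp [mixPhiPlus, PT, dotProduct, mulVec, Fintype.sum_prod_type, proj_vecKron_ket2_apply,
    proj_phiPlus_apply] at this
  linarith

lemma traceDist_mixPhiPlus_le {t : ℝ} (h0 : 0 ≤ t) :
    traceDist (proj (vecKron (ket2 0) (ket2 0))) (mixPhiPlus t) ≤ t := by
  refine le_of_sq_le_sq ?_ h0
  refine traceDist_sq_le.trans (le_of_eq ?_)
  have e : proj (vecKron (ket2 0) (ket2 0)) - mixPhiPlus t =
      (t : ℂ) • (proj (vecKron (ket2 0) (ket2 0)) - proj phiPlus) := by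
    rw [mixPhiPlus]
    push_cast
    module
  rw [e]
  simp [Fintype.sum_prod_type, proj_vecKron_ket2_apply, proj_phiPlus_apply]
  ring_nf
  norm_num
  ring

lemma posSemidef_proj_ket2 (a : Fin 2) : (proj (ket2 a)).PosSemidef :=
  posSemidef_vecMulVec_self_star _

lemma isState_proj_ket2 (a : Fin 2) : IsState (proj (ket2 a)) := by
  refine ⟨posSemidef_proj_ket2 a, ?_⟩
  fin_cases a <;> simp [proj, trace, vecMulVec_apply, ket2]

lemma classicalA_proj_vecKron_ket2 :
    ClassicalA (proj (vecKron (ket2 0) (ket2 0))) := by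
  refine ⟨ket2, fun i j => ?_, ![1, 0], fun _ => proj (ket2 0), ?_, fun _ => isState_proj_ket2 0, ?_⟩
  · fin_cases i <;> fin_cases j <;> simp [ket2]
  · simp [Fin.forall_fin_two]
  · simp [proj_vecKron]

/-- The operator `(X ⊗ X + Z ⊗ Z) / 32`. -/
def corr : Matrix (Fin 2 × Fin 2) (Fin 2 × Fin 2) ℂ :=
  (1 / 32 : ℂ) • (pauli 1 ⊗ₖ pauli 1 + pauli 3 ⊗ₖ pauli 3)

lemma isHermitian_corr : corr.IsHermitian := by
  ext ⟨a, b⟩ ⟨c, d⟩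
  fin_cases a <;> fin_cases b <;> fin_cases c <;> fin_cases d <;> simp [corr, pauli]

lemma norm_corr_le (p q : Fin 2 × Fin 2) : ‖corr p q‖ ≤ 1 / 32 := by
  obtain ⟨a, b⟩ := p
  obtain ⟨c, d⟩ := q
  fin_cases a <;> fin_cases b <;> fin_cases c <;> fin_cases d <;> simp [corr, pauli]

/-- The state `(1 + (X ⊗ X + Z ⊗ Z) / 32) / 4`. -/
def corrState : Matrix (Fin 2 × Fin 2) (Fin 2 × Fin 2) ℂ :=
  ((1 / 4 : ℝ) : ℂ) • (1 + corr)

lemma isState_corrState : IsState corrState := by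
  refine ⟨posSemidef_of_mem_sepCone (smul_mem_sepCone (by norm_num)
    (one_add_mem_sepCone isHermitian_corr fun p q => (norm_corr_le p q).trans (by norm_num))), ?_⟩
  simp [corrState, corr, pauli, trace, Fintype.sum_prod_type]
  norm_num

lemma not_classicalA_corrState : ¬ ClassicalA corrState := by
  intro h
  have h01 := congrFun₂ (h.commute 0 0 0 1).eq 0 1
  simp [mul_apply, corrState, corr, pauli, one_apply] at h01
  norm_num at h01

lemma separableState_of_traceDist_corrState_le {σ : Matrix (Fin 2 × Fin 2) (Fin 2 × Fin 2) ℂ}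
    (hσ : IsState σ) (h : traceDist corrState σ ≤ 1 / 256) : SeparableState σ := by
  have hD : (corrState - σ).IsHermitian := isState_corrState.1.1.sub hσ.1.1
  have e : σ = ((1 / 4 : ℝ) : ℂ) • (1 + (corr - ((4 : ℝ) : ℂ) • (corrState - σ))) := by
    rw [corrState]
    push_cast
    module
  refine separableState_of_mem_sepCone ?_ hσ.2
  rw [e]
  refine smul_mem_sepCone (by norm_num) (one_add_mem_sepCone ?_ fun p q => ?_)
  · exact isHermitian_corr.sub (by
      rw [IsHermitian, conjTranspose_smul, hD.eq, Complex.star_def, Complex.conj_ofReal])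
  · have h1 := norm_corr_le p q
    have h2 := norm_apply_le_traceDist hD p q
    have h3 := norm_sub_le (corr p q) (((4 : ℝ) : ℂ) * (corrState - σ) p q)
    rw [norm_mul, Complex.norm_real, Real.norm_of_nonneg (by norm_num : (0 : ℝ) ≤ 4)] at h3
    rw [Matrix.sub_apply, Matrix.smul_apply, smul_eq_mul]
    linarith

/-- on two qubits, (a) there is a classical-with-respect-to-`A`,
separable, boundary separable state; (b) there is a discordant state that is not
boundary separable. -/
theorem stmt_17 :
    (∃ ρ : Matrix (Fin 2 × Fin 2) (Fin 2 × Fin 2) ℂ,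
      IsState ρ ∧ ClassicalA ρ ∧ SeparableState ρ ∧
      ∀ ε : ℝ, 0 < ε → ∃ σ, EntangledState σ ∧ traceDist ρ σ ≤ ε) ∧
    (∃ ρ' : Matrix (Fin 2 × Fin 2) (Fin 2 × Fin 2) ℂ,
      IsState ρ' ∧ ¬ ClassicalA ρ' ∧
      ∃ ε : ℝ, 0 < ε ∧ ∀ σ, IsState σ → traceDist ρ' σ ≤ ε → SeparableState σ) := by
  have hE : ∀ ε : ℝ, 0 < ε → ∃ σ, EntangledState σ ∧
      traceDist (proj (vecKron (ket2 0) (ket2 0))) σ ≤ ε := fun ε hε =>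
    ⟨mixPhiPlus (min ε 1), entangledState_mixPhiPlus (lt_min hε one_pos) (min_le_right _ _),
      (traceDist_mixPhiPlus_le (le_min hε.le zero_le_one)).trans (min_le_left _ _)⟩
  have hmem : proj (vecKron (ket2 0) (ket2 0)) ∈ sepCone := by
    rw [proj_vecKron]
    exact kronecker_mem_sepCone (posSemidef_proj_ket2 0) (posSemidef_proj_ket2 0)
  have htr : (proj (vecKron (ket2 0) (ket2 0))).trace = 1 := by
    rw [proj_vecKron, trace_kronecker, (isState_proj_ket2 0).2, one_mul]
  exact ⟨⟨_, ⟨posSemidef_of_mem_sepCone hmem, htr⟩, classicalA_proj_vecKron_ket2,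
      separableState_of_mem_sepCone hmem htr, hE⟩,
    ⟨corrState, isState_corrState, not_classicalA_corrState, 1 / 256, by norm_num,
      fun _ hσ h => separableState_of_traceDist_corrState_le hσ h⟩⟩
end
end

section
/- Let N ≥ 2 and view N qubits as the bipartite system ℂ² ⊗ ℂ^{2^{N−1}} (first qubit versus the rest), with standard basis vectors |x⟩ indexed by bit strings x ∈ {0,1}^N. Let ρ_b = (1/(2^N − 1)) Σ_{x ≠ 1^N} |x⟩⟨x| (the 1-void state obtained by removing |1^N⟩ from the maximally mixed state I/2^N). Then δ(I/2^N, ρ_b) = 2^{−N}, ρ_b is separable, and for every ε > 0 there exists a state σ entangled across this cut with δ(I/2^N, σ) ≤ 2^{−N} + ε. -/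
open Matrix Kronecker BigOperators
open scoped ComplexOrder

noncomputable section

/-- The trace distance of two states whose difference is a real diagonal matrix. -/
theorem traceDist_of_sub_eq_diagonal {n : Type*} [Fintype n] [DecidableEq n]
    {ρ τ : Matrix n n ℂ} {d : n → ℝ} (h : ρ - τ = diagonal fun i => (d i : ℂ)) :
    traceDist ρ τ = (1 / 2) * ∑ i, |d i| := by
  have hH : (ρ - τ).IsHermitian := by
    rw [h]
    exact isHermitian_diagonal_of_self_adjoint _ (by ext i; simp)
  have hroots := hH.roots_charpoly_eq_eigenvalues
  have hdiag : (ρ - τ).charpoly.roots =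
      Multiset.map (fun i => (d i : ℂ)) Finset.univ.val := by
    rw [h, charpoly_diagonal, Polynomial.roots_prod]
    · simp
    · simp [Finset.prod_ne_zero_iff, Polynomial.X_sub_C_ne_zero]
  have hsum := congrArg (fun s => (Multiset.map (fun z : ℂ => ‖z‖) s).sum) (hroots.symm.trans hdiag)
  simp only [Multiset.map_map, Function.comp_def, Complex.coe_algebraMap,
    Complex.norm_real, Real.norm_eq_abs] at hsum
  rw [traceDist, dif_pos hH]
  exact congrArg _ hsum

/-- Writing `ρ - τ` as a difference of positive semidefinite matrices bounds the trace distance. -/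
theorem traceDist_le_of_sub_eq_sub {n : Type*} [Fintype n] [DecidableEq n]
    {ρ τ P Q : Matrix n n ℂ} (hP : P.PosSemidef) (hQ : Q.PosSemidef) (h : ρ - τ = P - Q) :
    traceDist ρ τ ≤ (1 / 2) * (P.trace.re + Q.trace.re) := by
  have hH : (ρ - τ).IsHermitian := h ▸ hP.1.sub hQ.1
  rw [traceDist, dif_pos hH]
  set U : Matrix n n ℂ := (hH.eigenvectorUnitary : Matrix n n ℂ)
  have hUU : U * Uᴴ = 1 := Unitary.coe_mul_star_self hH.eigenvectorUnitary
  have hconj : Uᴴ * (ρ - τ) * U = diagonal (RCLike.ofReal ∘ hH.eigenvalues) := by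
    rw [← hH.conjStarAlgAut_star_eigenvectorUnitary, Unitary.conjStarAlgAut_star_apply]
    rfl
  have htr (M : Matrix n n ℂ) : ∑ i, ((Uᴴ * M * U) i i).re = M.trace.re := by
    have : (Uᴴ * M * U).trace = M.trace := by
      rw [Matrix.trace_mul_comm, ← Matrix.mul_assoc, hUU, Matrix.one_mul]
    rw [← this, Matrix.trace, Complex.re_sum]
    rfl
  rw [← htr P, ← htr Q, ← Finset.sum_add_distrib]
  gcongr with i
  have hi : hH.eigenvalues i = ((Uᴴ * P * U) i i).re - ((Uᴴ * Q * U) i i).re := by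
    have hsub : Uᴴ * P * U - Uᴴ * Q * U = diagonal (RCLike.ofReal ∘ hH.eigenvalues) := by
      rw [← hconj, ← Matrix.sub_mul, ← Matrix.mul_sub, ← h]
    simpa using (congrArg (fun M : Matrix n n ℂ => (M i i).re) hsub).symm
  have hPi := (Complex.le_def.1 ((hP.conjTranspose_mul_mul_same U).diag_nonneg (i := i))).1
  have hQi := (Complex.le_def.1 ((hQ.conjTranspose_mul_mul_same U).diag_nonneg (i := i))).1
  simp only [Complex.zero_re] at hPi hQi
  rw [hi, abs_le]
  constructor <;> linarith

theorem proj_posSemidef {n : Type*} [Fintype n] (v : n → ℂ) : (proj v).PosSemidef :=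
  posSemidef_vecMulVec_self_star v

theorem proj_single_one {n : Type*} [DecidableEq n] (x : n) :
    proj (Pi.single x 1 : n → ℂ) = Matrix.single x x 1 := by
  ext i j
  simp only [proj, vecMulVec_apply, Pi.star_apply, Pi.single_apply, Matrix.single_apply]
  split_ifs <;> grind [star_one, star_zero]

theorem isState_single_s18 {n : Type*} [Fintype n] [DecidableEq n] (x : n) :
    IsState (Matrix.single x x (1 : ℂ)) :=
  ⟨proj_single_one x ▸ proj_posSemidef _, by simp⟩

/-- A row of a positive semidefinite matrix with vanishing diagonal entry vanishes. -/
theorem Matrix.PosSemidef.apply_eq_zero_of_diag_eq_zero {n : Type*} [Fintype n] [DecidableEq n]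
    {M : Matrix n n ℂ} (hM : M.PosSemidef) {i : n} (hi : M i i = 0) (j : n) : M j i = 0 := by
  have h := (hM.dotProduct_mulVec_zero_iff (Pi.single i 1)).1 (by
    simp [hi])
  simpa using congrFun h j

/-- A convex mixture of product basis states is separable. -/
theorem separableState_diagonal {dA dB : ℕ} {q : Fin dA × Fin dB → ℝ} (hq : ∀ x, 0 ≤ q x)
    (hsum : ∑ x, q x = 1) : SeparableState (diagonal fun x => (q x : ℂ)) := by
  let e := (Fintype.equivFin (Fin dA × Fin dB)).symm
  refine ⟨_, fun k => q (e k), fun k => Matrix.single (e k).1 (e k).1 1,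
    fun k => Matrix.single (e k).2 (e k).2 1, fun k => hq _, ?_, fun k => isState_single_s18 _,
    fun k => isState_single_s18 _, ?_⟩
  · rw [← hsum]
    exact e.sum_comp q
  · rw [e.sum_comp fun x => (q x : ℂ) • (Matrix.single x.1 x.1 1 ⊗ₖ Matrix.single x.2 x.2 1)]
    simp [single_kronecker_single, ← Matrix.sum_single_eq_diagonal]

/-- In a separable state a vanishing diagonal entry forces the vanishing of the corresponding
row of the partial transpose. -/
theorem SeparableState.apply_eq_zero_of_diag_eq_zero {dA dB : ℕ}
    {ρ : Matrix (Fin dA × Fin dB) (Fin dA × Fin dB) ℂ} (hρ : SeparableState ρ)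
    {i : Fin dA} {j : Fin dB} (h : ρ (i, j) (i, j) = 0) (i' : Fin dA) (j' : Fin dB) :
    ρ (i', j) (i, j') = 0 := by
  obtain ⟨m, p, A, B, hp, -, hA, hB, rfl⟩ := hρ
  simp only [Matrix.sum_apply, Matrix.smul_apply, kroneckerMap_apply, smul_eq_mul] at h ⊢
  rw [Finset.sum_eq_zero_iff_of_nonneg fun k _ =>
    mul_nonneg (Complex.zero_le_real.2 (hp k))
      (mul_nonneg (hA k).1.diag_nonneg (hB k).1.diag_nonneg)] at h
  refine Finset.sum_eq_zero fun k hk => ?_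
  rcases mul_eq_zero.1 (h k hk) with h | h
  · simp [h]
  rcases mul_eq_zero.1 h with h | h
  · simp [(hA k).1.apply_eq_zero_of_diag_eq_zero h i']
  · have := (hB k).1.apply_eq_zero_of_diag_eq_zero h j'
    rw [← (hB k).1.1.apply j j', this]
    simp

/-- A uniformly weighted mixture of all basis states except `e` is diagonal. -/
theorem smul_sum_proj_eq_diagonal {n : Type*} [Fintype n] [DecidableEq n] (c : ℝ) (e : n) :
    (c : ℂ) • ∑ x ∈ Finset.univ \ {e}, proj (Pi.single x 1 : n → ℂ) =
      diagonal fun x => ((if x = e then 0 else c : ℝ) : ℂ) := by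
  ext i j
  simp only [proj_single_one, Matrix.smul_apply, Matrix.sum_apply, Matrix.single_apply,
    diagonal_apply, smul_eq_mul]
  by_cases hij : i = j
  · subst hij
    by_cases hi : i = e <;> simp [hi]
  · rw [Finset.sum_eq_zero]
    · simp [hij]
    · rintro x -
      exact if_neg fun h => hij (h.1.symm.trans h.2)

theorem sum_ite_eq_const {n : Type*} [Fintype n] [DecidableEq n] (e : n) (a b : ℝ) :
    ∑ x, (if x = e then a else b) = a + (Fintype.card n - 1) * b := by
  rw [Finset.sum_ite, Finset.filter_eq', if_pos (Finset.mem_univ e), Finset.sum_singleton,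
    Finset.sum_const, nsmul_eq_mul, Finset.filter_ne', Finset.card_erase_of_mem (Finset.mem_univ e),
    Finset.card_univ, Nat.cast_sub (Fintype.card_pos_iff.2 ⟨e⟩), Nat.cast_one]

/-- Near the maximally mixed state on `ℂ^dA ⊗ ℂ^dB`, with `dA, dB ≥ 2` and `D = dA * dB`, there
is an entangled state at trace distance at most `1 / D`. -/
theorem exists_entangledState_traceDist_le {dA dB : ℕ} {i i' : Fin dA} {j j' : Fin dB}
    (hi : i ≠ i') (hj : j ≠ j') {D : ℝ} (hD : D = dA * dB) :
    ∃ σ, EntangledState σ ∧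
      traceDist ((D : ℂ)⁻¹ • (1 : Matrix (Fin dA × Fin dB) (Fin dA × Fin dB) ℂ)) σ ≤ D⁻¹ := by
  have hD0 : 0 < D := by
    rw [hD]
    exact mul_pos (Nat.cast_pos.2 i.pos) (Nat.cast_pos.2 j.pos)
  have hDinv : (0 : ℂ) ≤ (D : ℂ)⁻¹ := by
    rw [← Complex.ofReal_inv]
    exact Complex.zero_le_real.2 (inv_nonneg.2 hD0.le)
  have hhalf : (0 : ℂ) ≤ (2 : ℂ)⁻¹ := by
    simp
  let v : Fin dA × Fin dB → ℂ := Pi.single (i', j) 1 + Pi.single (i, j') 1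
  let P : Matrix (Fin dA × Fin dB) (Fin dA × Fin dB) ℂ :=
    (D : ℂ)⁻¹ • Matrix.single (i, j) (i, j) 1
  let Q : Matrix (Fin dA × Fin dB) (Fin dA × Fin dB) ℂ := (D : ℂ)⁻¹ • (2 : ℂ)⁻¹ • proj v
  have hP : P.PosSemidef := (isState_single_s18 _).1.smul hDinv
  have hQ : Q.PosSemidef := ((proj_posSemidef v).smul hhalf).smul hDinv
  have hvv : (proj v).trace = 2 := by
    simp only [proj, trace_vecMulVec, v]
    simp [hi, hi.symm]
    norm_num
  have hPt : P.trace = (D : ℂ)⁻¹ := by simp [P]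
  have hQt : Q.trace = (D : ℂ)⁻¹ := by simp [Q, hvv]
  have hPc : ((D : ℂ)⁻¹ • (1 : Matrix (Fin dA × Fin dB) (Fin dA × Fin dB) ℂ) - P).PosSemidef := by
    have : (D : ℂ)⁻¹ • (1 : Matrix (Fin dA × Fin dB) (Fin dA × Fin dB) ℂ) - P =
        (D : ℂ)⁻¹ • diagonal fun x => if x = (i, j) then 0 else 1 := by
      ext x y
      simp only [P, Matrix.sub_apply, Matrix.smul_apply, Matrix.one_apply, Matrix.single_apply,
        diagonal_apply, smul_eq_mul]
      grind
    rw [this]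
    refine PosSemidef.smul (PosSemidef.diagonal fun x => ?_) hDinv
    dsimp only [Pi.zero_apply]
    split_ifs <;> simp
  refine ⟨(D : ℂ)⁻¹ • 1 - P + Q, ⟨⟨hPc.add hQ, ?_⟩, fun hsep => ?_⟩, ?_⟩
  · rw [trace_add, trace_sub, hPt, hQt, sub_add_cancel, trace_smul, trace_one]
    simp only [Fintype.card_prod, Fintype.card_fin, smul_eq_mul, Nat.cast_mul]
    have : (D : ℂ) = dA * dB := by simp [hD]
    rw [← this]
    exact inv_mul_cancel₀ (Complex.ofReal_ne_zero.2 hD0.ne')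
  · have h := hsep.apply_eq_zero_of_diag_eq_zero (i := i) (j := j)
      (by simp [P, Q, v, proj, vecMulVec_apply, hi, hj]) i' j'
    simp [P, Q, v, proj, vecMulVec_apply, hi, hi.symm, hD0.ne'] at h
  · refine (traceDist_le_of_sub_eq_sub hP hQ (by abel)).trans_eq ?_
    rw [hPt, hQt, ← Complex.ofReal_inv, Complex.ofReal_re]
    ring

/-- for `N ≥ 2` qubits, cut as `ℂ² ⊗ ℂ^{2^{N−1}}` (first qubit versus the
rest), the 1-void state `ρ_b = (1/(2^N − 1)) Σ_{x ≠ 1^N} |x⟩⟨x|` satisfies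
`δ(I/2^N, ρ_b) = 2^{−N}`, is separable, and for every `ε > 0` there is a state entangled
across this cut within distance `2^{−N} + ε` of the maximally mixed state. -/
theorem stmt_18 (N : ℕ) (hN : 2 ≤ N)
    (ρb : Matrix (Fin 2 × Fin (2 ^ (N - 1))) (Fin 2 × Fin (2 ^ (N - 1))) ℂ)
    (hρb : ρb = (((2 ^ N - 1 : ℝ)) : ℂ)⁻¹ •
      ∑ x ∈ Finset.univ \
          {((⟨1, by omega⟩ : Fin 2),
            (⟨2 ^ (N - 1) - 1, Nat.sub_lt (by positivity) (by norm_num)⟩ :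
              Fin (2 ^ (N - 1))))},
        proj (Pi.single x 1 : Fin 2 × Fin (2 ^ (N - 1)) → ℂ)) :
    traceDist (((2 ^ N : ℝ) : ℂ)⁻¹ •
        (1 : Matrix (Fin 2 × Fin (2 ^ (N - 1))) (Fin 2 × Fin (2 ^ (N - 1))) ℂ)) ρb =
      (2 ^ N : ℝ)⁻¹ ∧
    SeparableState ρb ∧
    ∀ ε : ℝ, 0 < ε → ∃ σ, EntangledState σ ∧
      traceDist (((2 ^ N : ℝ) : ℂ)⁻¹ •
          (1 : Matrix (Fin 2 × Fin (2 ^ (N - 1))) (Fin 2 × Fin (2 ^ (N - 1))) ℂ)) σ ≤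
        (2 ^ N : ℝ)⁻¹ + ε := by
  have hcard : (Fintype.card (Fin 2 × Fin (2 ^ (N - 1))) : ℝ) = 2 ^ N := by
    obtain ⟨k, rfl⟩ : ∃ k, N = k + 1 := ⟨N - 1, by omega⟩
    simp [pow_succ, mul_comm]
  have hN1 : 1 < 2 ^ (N - 1) := Nat.one_lt_two_pow (by omega)
  have hD1 : (1 : ℝ) < 2 ^ N := one_lt_pow₀ one_lt_two (by omega)
  have hD0 : (0 : ℝ) < 2 ^ N := by positivity
  have hD1' : (0 : ℝ) < 2 ^ N - 1 := sub_pos.2 hD1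
  obtain ⟨e, rfl⟩ : ∃ e, ρb = diagonal fun x =>
      ((if x = e then 0 else (2 ^ N - 1 : ℝ)⁻¹ : ℝ) : ℂ) :=
    ⟨_, hρb.trans (by rw [← Complex.ofReal_inv, smul_sum_proj_eq_diagonal])⟩
  refine ⟨?_, ?_, fun ε hε => ?_⟩
  · rw [traceDist_of_sub_eq_diagonal (d := fun x => if x = e then (2 ^ N : ℝ)⁻¹ else
      (2 ^ N : ℝ)⁻¹ - (2 ^ N - 1 : ℝ)⁻¹)]
    · simp only [apply_ite abs]
      rw [sum_ite_eq_const, hcard, abs_of_pos (inv_pos.2 hD0),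
        abs_of_nonpos (sub_nonpos.2 (inv_anti₀ hD1' (by linarith)))]
      field_simp
      ring
    · rw [smul_one_eq_diagonal, diagonal_sub]
      congr 1
      ext x
      split_ifs <;> simp
  · refine separableState_diagonal (fun x => ?_) ?_
    · split_ifs
      exacts [le_rfl, (inv_pos.2 hD1').le]
    · rw [sum_ite_eq_const, hcard, zero_add, mul_inv_cancel₀ hD1'.ne']
  · obtain ⟨σ, hσ, hle⟩ := exists_entangledState_traceDist_le (i := (0 : Fin 2)) (i' := 1)
      (j := (⟨0, by omega⟩ : Fin (2 ^ (N - 1)))) (j' := ⟨1, hN1⟩) (by simp) (by simp)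
      (D := 2 ^ N) (by simpa using hcard.symm)
    exact ⟨σ, hσ, hle.trans (by linarith)⟩
end
end
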